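/- arXiv:2503.11479 — 2 statements merged into one kernel-verified Lean document; each statement's English description precedes it below -/
import Mathlib

section
/- Let E be a measurable space, μ a probability measure on E, and κ, κʳ two Markov kernels from E to E satisfying the skew-detailed-balance relation ∫_A κ(z)(B) μ(dz) = ∫_B κʳ(z)(A) μ(dz) for all measurable A, B ⊆ E. Define the Markov kernel q on E × {−1, 1} by: from state (z, 1), draw z′ ∼ κ(z) and move to (z′, −1); from state (z, −1), draw z′ ∼ κʳ(z) and move to (z′, 1). Then q satisfies detailed balance with respect to the product measure μ ⊗ u, where u is the uniform probability measure on {−1, 1}: for all measurable A′, B′ ⊆ E × {−1, 1}, ∫_{A′} q(w)(B′) d(μ ⊗ u)(w) = ∫_{B′} q(w)(A′) d(μ ⊗ u)(w). Consequently μ ⊗ u is an invariant measure for q. -/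
open MeasureTheory ProbabilityTheory
open scoped ENNReal

/-- Integrating over a measurable set against the product of `μ` with the uniform measure on `Bool`
amounts to averaging the integrals over the two slices. -/
theorem setLIntegral_prod_uniform_bool {E : Type*} [MeasurableSpace E] (μ : Measure E) [SFinite μ]
    {f : E × Bool → ℝ≥0∞} (hf : Measurable f) {A : Set (E × Bool)} (hA : MeasurableSet A) :
    ∫⁻ w in A, f w ∂(μ.prod ((2 : ℝ≥0∞)⁻¹ • (Measure.dirac true + Measure.dirac false))) =
      2⁻¹ * (∫⁻ z in (fun z => (z, true)) ⁻¹' A, f (z, true) ∂μ +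
        ∫⁻ z in (fun z => (z, false)) ⁻¹' A, f (z, false) ∂μ) := by
  rw [Measure.prod_smul_right, Measure.prod_add, Measure.prod_dirac, Measure.prod_dirac,
    Measure.restrict_smul, Measure.restrict_add, lintegral_smul_measure, lintegral_add_measure,
    setLIntegral_map hA hf measurable_prodMk_right,
    setLIntegral_map hA hf measurable_prodMk_right, smul_eq_mul]

/-- Skew-reversibility proposition: if the forward kernel `κ` and the reverse kernel `κr`
satisfy the skew-detailed-balance relation with respect to `μ`, then the kernel `q` on
`E × {−1,1}` (here `{−1,1}` is modelled by `Bool`, `true ↔ +1`) that follows `κ` and flips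
the direction when the direction is `+1`, and follows `κr` and flips the direction when the
direction is `−1`, satisfies detailed balance with respect to `μ ⊗ u`, `u` uniform on
`{−1,1}`; consequently `μ ⊗ u` is invariant for `q`. -/
theorem skew_reversibility_detailed_balance
    {E : Type*} [MeasurableSpace E]
    (μ : Measure E) [IsProbabilityMeasure μ]
    (κ κr : Kernel E E) [IsMarkovKernel κ] [IsMarkovKernel κr]
    (hskew : ∀ A B : Set E, MeasurableSet A → MeasurableSet B →
      ∫⁻ z in A, κ z B ∂μ = ∫⁻ z in B, κr z A ∂μ)
    (q : E × Bool → Measure (E × Bool))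
    (hq₁ : ∀ z : E, q (z, true) = (κ z).map (fun z' => (z', false)))
    (hq₂ : ∀ z : E, q (z, false) = (κr z).map (fun z' => (z', true)))
    (u : Measure Bool)
    (hu : u = (2 : ℝ≥0∞)⁻¹ • (Measure.dirac true + Measure.dirac false)) :
    (∀ A' B' : Set (E × Bool), MeasurableSet A' → MeasurableSet B' →
      ∫⁻ w in A', q w B' ∂(μ.prod u) = ∫⁻ w in B', q w A' ∂(μ.prod u)) ∧
    (∀ B' : Set (E × Bool), MeasurableSet B' →
      ∫⁻ w, q w B' ∂(μ.prod u) = (μ.prod u) B') := by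
  subst hu
  have hq_true (z : E) {B : Set (E × Bool)} (hB : MeasurableSet B) :
      q (z, true) B = κ z ((fun z => (z, false)) ⁻¹' B) := by
    rw [hq₁, Measure.map_apply measurable_prodMk_right hB]
  have hq_false (z : E) {B : Set (E × Bool)} (hB : MeasurableSet B) :
      q (z, false) B = κr z ((fun z => (z, true)) ⁻¹' B) := by
    rw [hq₂, Measure.map_apply measurable_prodMk_right hB]
  have hq_meas {B : Set (E × Bool)} (hB : MeasurableSet B) : Measurable fun w => q w B := by
    refine measurable_from_prod_countable_left fun b => ?_
    cases b
    · simp only [hq_false _ hB]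
      exact κr.measurable_coe (measurable_prodMk_right hB)
    · simp only [hq_true _ hB]
      exact κ.measurable_coe (measurable_prodMk_right hB)
  have hbalance (A B : Set (E × Bool)) (hA : MeasurableSet A) (hB : MeasurableSet B) :
      ∫⁻ w in A, q w B ∂(μ.prod ((2 : ℝ≥0∞)⁻¹ • (Measure.dirac true + Measure.dirac false))) =
        ∫⁻ w in B, q w A
          ∂(μ.prod ((2 : ℝ≥0∞)⁻¹ • (Measure.dirac true + Measure.dirac false))) := by
    rw [setLIntegral_prod_uniform_bool μ (hq_meas hB) hA,
      setLIntegral_prod_uniform_bool μ (hq_meas hA) hB]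
    simp only [hq_true _ hA, hq_true _ hB, hq_false _ hA, hq_false _ hB]
    rw [hskew _ _ (measurable_prodMk_right hA) (measurable_prodMk_right hB),
      hskew _ _ (measurable_prodMk_right hB) (measurable_prodMk_right hA), add_comm]
  have hq_univ (w : E × Bool) : q w Set.univ = 1 := by
    obtain ⟨z, _ | _⟩ := w
    · simp [hq_false z MeasurableSet.univ]
    · simp [hq_true z MeasurableSet.univ]
  refine ⟨hbalance, fun B hB => ?_⟩
  rw [← setLIntegral_univ, hbalance _ _ MeasurableSet.univ hB]
  simp only [hq_univ, setLIntegral_one]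
end

section
/- Let (W, ν) be a σ-finite measure space, R : W → W a measurable involution (R ∘ R = id), and ψ : W → (0, ∞) a measurable function such that ∫ g(R w) ν(dw) = ∫ g(w) ψ(w) ν(dw) for every nonnegative measurable g (i.e., ψ is the volume change of R with respect to ν). Let f : W → [0, ∞) be measurable and define the Metropolis acceptance probability α(w) = min(1, f(R w) ψ(w) / f(w)) when f(w) > 0 and α(w) = 1 otherwise. Then the proposal w ↦ R w accepted with probability α(w) is in detailed balance with respect to the measure f·ν: for every nonnegative measurable g : W × W → [0, ∞), ∫ g(w, R w) f(w) α(w) ν(dw) = ∫ g(R w, w) f(w) α(w) ν(dw). Moreover, if f(R w) ψ(w) = f(w) for ν-almost every w (exact skew-reversibility), then α(w) = 1 for ν-almost every w with f(w) > 0. -/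
open MeasureTheory
open scoped ENNReal NNReal

/-- The volume change of a measurable involution is almost everywhere inverse to its own
reflection. -/
theorem ae_mul_comp_involution_eq_one
    {W : Type*} [MeasurableSpace W] (ν : Measure W) [SigmaFinite ν]
    {R : W → W} (hRmeas : Measurable R) (hRinv : Function.Involutive R)
    {ψ : W → ℝ≥0} (hψmeas : Measurable ψ)
    (hψ : ∀ g : W → ℝ≥0∞, Measurable g →
      ∫⁻ w, g (R w) ∂ν = ∫⁻ w, g w * (ψ w : ℝ≥0∞) ∂ν) :
    ∀ᵐ w ∂ν, ψ (R w) * ψ w = 1 := by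
  have key : (fun w ↦ (ψ (R w) : ℝ≥0∞) * ψ w) =ᵐ[ν] fun _ ↦ 1 := by
    refine ae_eq_of_forall_setLIntegral_eq_of_sigmaFinite (by fun_prop) (by fun_prop) ?_
    intro s hs _
    set χ : W → ℝ≥0∞ := s.indicator 1
    have hχ : Measurable χ := measurable_one.indicator hs
    calc ∫⁻ w in s, (ψ (R w) : ℝ≥0∞) * ψ w ∂ν
        = ∫⁻ w, χ w * ψ (R w) * ψ w ∂ν := by
          rw [← lintegral_indicator hs]
          refine lintegral_congr fun w ↦ ?_
          by_cases hw : w ∈ s <;> simp [χ, hw]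
      _ = ∫⁻ w, χ (R w) * ψ (R (R w)) ∂ν :=
          (hψ (fun w ↦ χ w * ψ (R w)) (by fun_prop)).symm
      _ = ∫⁻ w, χ (R w) * ψ w ∂ν := by simp only [hRinv _]
      _ = ∫⁻ w, χ (R (R w)) ∂ν := (hψ (fun w ↦ χ (R w)) (by fun_prop)).symm
      _ = ∫⁻ _ in s, 1 ∂ν := by
          simp only [hRinv _, χ, lintegral_indicator hs, Pi.one_apply]
  filter_upwards [key] with w hw
  exact_mod_cast hw

/-- Metropolis adjustment with an involutive proposal `R` whose volume change is `ψ`: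
the move `w ↦ R w`, accepted with probability
`α w = min 1 (f (R w) ψ w / f w)` (and `α w = 1` when `f w = 0`), is in detailed balance
with respect to the measure `f · ν`; moreover, if `f (R w) ψ w = f w` for `ν`-a.e. `w`
(exact skew-reversibility), then `α w = 1` for `ν`-a.e. `w` with `f w > 0`. -/
theorem metropolis_involution_detailed_balance
    {W : Type*} [MeasurableSpace W] (ν : Measure W) [SigmaFinite ν]
    (R : W → W) (hRmeas : Measurable R) (hRinv : R ∘ R = id)
    (ψ : W → ℝ≥0) (hψmeas : Measurable ψ) (hψpos : ∀ w, 0 < ψ w)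
    (hψ : ∀ g : W → ℝ≥0∞, Measurable g →
      ∫⁻ w, g (R w) ∂ν = ∫⁻ w, g w * (ψ w : ℝ≥0∞) ∂ν)
    (f : W → ℝ≥0) (hfmeas : Measurable f)
    (α : W → ℝ≥0)
    (hα : ∀ w, α w = if f w = 0 then 1 else min 1 (f (R w) * ψ w / f w)) :
    (∀ g : W × W → ℝ≥0∞, Measurable g →
      ∫⁻ w, g (w, R w) * (f w : ℝ≥0∞) * (α w : ℝ≥0∞) ∂ν
        = ∫⁻ w, g (R w, w) * (f w : ℝ≥0∞) * (α w : ℝ≥0∞) ∂ν) ∧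
    ((∀ᵐ w ∂ν, f (R w) * ψ w = f w) → ∀ᵐ w ∂ν, 0 < f w → α w = 1) := by
  have hR : Function.Involutive R := congrFun hRinv
  have hfα : ∀ w, f w * α w = min (f w) (f (R w) * ψ w) := by
    intro w
    rw [hα]
    split_ifs with h
    · simp [h]
    · rw [mul_min, mul_one, mul_div_cancel₀ _ h]
  have hαmeas : Measurable α := by
    rw [funext hα]
    exact Measurable.ite (hfmeas (measurableSet_singleton 0)) measurable_const (by fun_prop)
  refine ⟨fun g hg ↦ ?_, fun h ↦ ?_⟩
  · calc ∫⁻ w, g (w, R w) * (f w : ℝ≥0∞) * (α w : ℝ≥0∞) ∂ν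
        = ∫⁻ w, g (R (R w), R w) * (f (R (R w)) : ℝ≥0∞) * (α (R (R w)) : ℝ≥0∞) ∂ν := by
          simp only [hR _]
      _ = ∫⁻ w, g (R w, w) * (f (R w) : ℝ≥0∞) * (α (R w) : ℝ≥0∞) * (ψ w : ℝ≥0∞) ∂ν :=
          hψ (fun w ↦ g (R w, w) * (f (R w) : ℝ≥0∞) * (α (R w) : ℝ≥0∞)) (by fun_prop)
      _ = ∫⁻ w, g (R w, w) * (f w : ℝ≥0∞) * (α w : ℝ≥0∞) ∂ν := by
          refine lintegral_congr_ae ?_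
          filter_upwards [ae_mul_comp_involution_eq_one ν hRmeas hR hψmeas hψ] with w hw
          have hbalance : f (R w) * α (R w) * ψ w = f w * α w := by
            rw [hfα, hfα, hR, min_mul, mul_assoc, hw, mul_one, min_comm]
          simp only [mul_assoc]
          congr 1
          rw [mul_assoc] at hbalance
          exact_mod_cast hbalance
  · filter_upwards [h] with w hw hpos
    rw [hα, if_neg hpos.ne', hw, div_self hpos.ne', min_self]
end
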